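/- Assume the set S of states is finite, the system is AG EF terminating, and 𝒯 is a stubborn set assignment satisfying D0, D1 and D2. Let t_ω be a transition and T_* a set of transitions. Then there exists an infinite execution from ŝ in which t_ω occurs infinitely many times but no member of T_* occurs infinitely many times, if and only if there exists an infinite r-execution from ŝ with the same property. -/

import Mathlib

/-- `TPath step s σ s'` means `s →[σ] s'`: firing the sequence `σ` of transitions
from `s` yields `s'`. -/
inductive TPath {S T : Type*} (step : S → T → S → Prop) : S → List T → S → Prop
  | nil (s : S) : TPath step s [] s
  | cons {s s' s'' : S} {t : T} {σ : List T} :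
      step s t s' → TPath step s' σ s'' → TPath step s (t :: σ) s''

/-- Transition `t` is enabled at `s`. -/
def Enabled {S T : Type*} (step : S → T → S → Prop) (s : S) (t : T) : Prop :=
  ∃ s', step s t s'

/-- A state is terminal iff no transition is enabled at it. -/
def Terminal {S T : Type*} (step : S → T → S → Prop) (s : S) : Prop :=
  ∀ t, ¬ Enabled step s t

/-- `s'` is reachable from `s`. -/
def Reachable {S T : Type*} (step : S → T → S → Prop) (s s' : S) : Prop :=
  ∃ σ, TPath step s σ s'

/-- An r-edge: a step `s →[t] s'` with `t ∈ 𝒯 s`. -/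
def REdge {S T : Type*} (step : S → T → S → Prop) (𝒯 : S → Set T)
    (s : S) (t : T) (s' : S) : Prop :=
  step s t s' ∧ t ∈ 𝒯 s

/-- The transition relation is deterministic. -/
def Deterministic {S T : Type*} (step : S → T → S → Prop) : Prop :=
  ∀ s t s₁ s₂, step s t s₁ → step s t s₂ → s₁ = s₂

/-- D0: if `s₀` is not terminal then `𝒯 s₀` contains an enabled transition. -/
def D0 {S T : Type*} (step : S → T → S → Prop) (𝒯 : S → Set T) : Prop :=
  ∀ s₀, ¬ Terminal step s₀ → ∃ t ∈ 𝒯 s₀, Enabled step s₀ t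

/-- D1: if `t ∈ 𝒯 s₀`, `t₁,…,tₙ ∉ 𝒯 s₀` and `s₀ →[t₁⋯tₙ t] s'`
then `s₀ →[t t₁⋯tₙ] s'`. -/
def D1 {S T : Type*} (step : S → T → S → Prop) (𝒯 : S → Set T) : Prop :=
  ∀ s₀ t σ s', t ∈ 𝒯 s₀ → (∀ u ∈ σ, u ∉ 𝒯 s₀) →
    TPath step s₀ (σ ++ [t]) s' → TPath step s₀ (t :: σ) s'

/-- D2: if `t ∈ 𝒯 s₀` is enabled at `s₀`, `t₁,…,tₙ ∉ 𝒯 s₀` and `s₀ →[t₁⋯tₙ] sₙ`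
then `t` is enabled at `sₙ`. -/
def D2 {S T : Type*} (step : S → T → S → Prop) (𝒯 : S → Set T) : Prop :=
  ∀ s₀ t σ sₙ, t ∈ 𝒯 s₀ → Enabled step s₀ t → (∀ u ∈ σ, u ∉ 𝒯 s₀) →
    TPath step s₀ σ sₙ → Enabled step sₙ t

theorem TPath.append {S T : Type*} {step : S → T → S → Prop} {s s' s'' : S} {σ τ : List T}
    (h : TPath step s σ s') (h' : TPath step s' τ s'') : TPath step s (σ ++ τ) s'' := by
  induction h with
  | nil s => exact h'
  | cons hs _ ih => exact .cons hs (ih h')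

theorem TPath.of_append {S T : Type*} {step : S → T → S → Prop} {s s'' : S} {σ τ : List T}
    (h : TPath step s (σ ++ τ) s'') : ∃ s', TPath step s σ s' ∧ TPath step s' τ s'' := by
  induction σ generalizing s with
  | nil => exact ⟨s, .nil s, h⟩
  | cons t σ ih =>
    cases h with
    | cons hs h =>
      obtain ⟨s', h₁, h₂⟩ := ih h
      exact ⟨s', .cons hs h₁, h₂⟩

/-- The sequence of states visited along a path, as a function on `ℕ`. -/
theorem TPath.exists_states {S T : Type*} {step : S → T → S → Prop} {s s' : S} {σ : List T}
    (h : TPath step s σ s') :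
    ∃ q : ℕ → S, q 0 = s ∧ ∀ i (hi : i < σ.length), step (q i) σ[i] (q (i + 1)) := by
  induction h with
  | nil s => exact ⟨fun _ => s, rfl, fun i hi => by simp at hi⟩
  | @cons s _ _ _ _ hs _ ih =>
    obtain ⟨q, hq0, hq⟩ := ih
    refine ⟨fun n => n.casesOn s q, rfl, fun i hi => ?_⟩
    cases i with
    | zero => simpa [hq0] using hs
    | succ i => simpa using hq i (by simpa using hi)

theorem tPath_map_range {S T : Type*} {step : S → T → S → Prop} {f : ℕ → S} {g : ℕ → T}
    (h : ∀ n, step (f n) (g n) (f (n + 1))) (n : ℕ) :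
    TPath step (f 0) ((List.range n).map g) (f n) := by
  induction n with
  | zero => exact .nil _
  | succ n ih =>
    rw [List.range_succ, List.map_append]
    exact ih.append (.cons (h n) (.nil _))

/-- Every path to a terminal state can be permuted into a path consisting of r-edges. -/
theorem TPath.exists_perm_rEdge {S T : Type*} {step : S → T → S → Prop} {𝒯 : S → Set T}
    (h0 : D0 step 𝒯) (h1 : D1 step 𝒯) (h2 : D2 step 𝒯) {s s' : S} (hs' : Terminal step s')
    {σ : List T} (h : TPath step s σ s') :
    ∃ σ' : List T, σ'.Perm σ ∧ TPath (REdge step 𝒯) s σ' s' := by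
  classical
  induction hn : σ.length generalizing s σ with
  | zero =>
    obtain rfl := List.length_eq_zero_iff.mp hn
    cases h
    exact ⟨[], .nil, .nil _⟩
  | succ n ih =>
    have hex : ∃ u ∈ σ, u ∈ 𝒯 s := by
      by_contra! hno
      have hnt : ¬ Terminal step s := by
        intro ht
        cases h with
        | nil => simp at hn
        | cons hs _ => exact ht _ ⟨_, hs⟩
      obtain ⟨t, ht, hen⟩ := h0 s hnt
      exact hs' t (h2 s t σ s' ht hen hno h)
    obtain ⟨t, α, β, hα, ht, hσ, -⟩ :=
      List.exists_of_eraseP (p := fun u => decide (u ∈ 𝒯 s)) hex.choose_spec.1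
        (by simpa using hex.choose_spec.2)
    rw [decide_eq_true_eq] at ht
    have hsplit : σ = (α ++ [t]) ++ β := by simp [hσ]
    rw [hsplit] at h
    obtain ⟨x, hx, hx'⟩ := h.of_append
    have hmove := (h1 s t α x ht (fun u hu => by simpa using hα u hu) hx).append hx'
    rw [List.cons_append] at hmove
    cases hmove with
    | cons hst hrest =>
      obtain ⟨σ', hp, hr⟩ := ih hrest (by rw [hσ] at hn; simp at hn ⊢; omega)
      refine ⟨t :: σ', ?_, .cons ⟨hst, ht⟩ hr⟩
      rw [hσ]
      exact (hp.cons t).trans List.perm_middle.symm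

theorem List.card_filter_getElem_eq {T : Type*} [DecidableEq T] (σ : List T) (a : T) :
    (Finset.univ.filter fun i : Fin σ.length => σ[i] = a).card = σ.count a := by
  conv_rhs => rw [← List.ofFn_getElem (xs := σ)]
  rw [List.ofFn_eq_map, List.count, List.countP_map]
  have h := Multiset.countP_eq_card_filter (p := fun i : Fin σ.length => σ[i] = a)
    (Finset.univ : Finset (Fin σ.length)).val
  exact h.symm

theorem List.not_of_countP_take_eq {T : Type*} {p : T → Bool} {σ : List T} {i j k : ℕ}
    (h : (σ.take i).countP p = (σ.take j).countP p) (hik : i ≤ k) (hkj : k < j)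
    (hk : k < σ.length) : ¬ p σ[k] := by
  intro hp
  have h₁ : (σ.take i).countP p ≤ (σ.take k).countP p :=
    ((List.take_prefix_take_left hik).sublist).countP_le
  have h₂ : (σ.take (k + 1)).countP p ≤ (σ.take j).countP p :=
    ((List.take_prefix_take_left hkj).sublist).countP_le
  rw [List.take_succ_eq_append_getElem hk, List.countP_append] at h₂
  simp [hp] at h₂
  omega

/-- A path on which `a` occurs often compared to the labels satisfying `p` contains a cycle
that starts with `a` and avoids `p`. -/
theorem TPath.exists_cycle {S T : Type*} [Fintype S] [DecidableEq T] {step : S → T → S → Prop}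
    {s s' : S} {σ : List T} (h : TPath step s σ s') (a : T) (p : T → Bool) (K : ℕ)
    (hK : σ.countP p ≤ K) (ha : Fintype.card S * (K + 1) < σ.count a) :
    ∃ (m : ℕ) (c : ℕ → S) (l : ℕ → T), 0 < m ∧ (∃ τ, TPath step s τ (c 0)) ∧ c m = c 0 ∧
      l 0 = a ∧ ∀ k < m, step (c k) (l k) (c (k + 1)) ∧ ¬ p (l k) := by
  obtain ⟨q, hq0, hq⟩ := h.exists_states
  rw [← List.card_filter_getElem_eq] at ha
  obtain ⟨i, hi, j, hj, hne, heq⟩ := Finset.exists_ne_map_eq_of_card_lt_of_maps_to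
    (t := (Finset.univ : Finset S) ×ˢ Finset.range (K + 1))
    (f := fun i : Fin σ.length => (q i, (σ.take i).countP p))
    (by simpa using ha)
    (by
      intro i _
      have := ((List.take_sublist (i : ℕ) σ).countP_le (p := p)).trans hK
      simp
      omega)
  wlog hij : i < j generalizing i j
  · exact this j hj i hi hne.symm heq.symm (lt_of_le_of_ne (not_lt.mp hij) hne.symm)
  simp only [Prod.mk.injEq] at heq
  have hreach : ∀ n ≤ σ.length, ∃ τ, TPath step s τ (q n) := by
    intro n hn
    induction n with
    | zero => exact ⟨[], hq0 ▸ .nil _⟩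
    | succ n ih =>
      obtain ⟨τ, hτ⟩ := ih (by omega)
      exact ⟨_, hτ.append (.cons (hq n hn) (.nil _))⟩
  have hij' : (i : ℕ) < j := hij
  have hjl := j.isLt
  refine ⟨j - i, fun k => q (i + k), fun k => (σ[(i : ℕ) + k]?).getD a, by omega,
    hreach i i.isLt.le, ?_, ?_, fun k hk => ?_⟩
  · simp only [Nat.add_sub_cancel' hij'.le, Nat.add_zero, heq.1]
  · have := (Finset.mem_filter.mp hi).2
    simpa using this
  · have hk' : (i : ℕ) + k < σ.length := by omega
    simp only [List.getElem?_eq_getElem hk', Option.getD_some]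
    exact ⟨hq _ hk', List.not_of_countP_take_eq heq.2 (by omega) (by omega) hk'⟩

/-- A nonempty set of labels that is infinite or not contained in `A` can be enumerated
so that no element of `A` recurs infinitely often. -/
theorem exists_seq_finite_recurrence {T : Type*} {E A : Set T} (h : E.Infinite ∨ ¬ E ⊆ A) :
    ∃ L : ℕ → T, (∀ k, L k ∈ E) ∧ ∀ t ∈ A, {k | L k = t}.Finite := by
  rcases h with h | h
  · refine ⟨fun k => h.natEmbedding E k, fun k => Subtype.coe_prop _, fun t _ => ?_⟩
    refine Set.Subsingleton.finite fun x hx y hy => ?_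
    exact (h.natEmbedding E).injective (Subtype.ext (hx.trans hy.symm))
  · obtain ⟨x, hx, hxA⟩ := Set.not_subset.mp h
    refine ⟨fun _ => x, fun _ => hx, fun t ht => ?_⟩
    have : {k : ℕ | x = t} = ∅ :=
      Set.eq_empty_of_forall_notMem fun _ hk => hxA (hk ▸ ht)
    exact this ▸ Set.finite_empty

/-- There is an infinite execution from `s` in which `a` occurs infinitely many times but no
member of `A` does. -/
def HasRecurrentExecution {S T : Type*} (step : S → T → S → Prop) (a : T) (A : Set T)
    (s : S) : Prop :=
  ∃ (f : ℕ → S) (g : ℕ → T), f 0 = s ∧ (∀ n, step (f n) (g n) (f (n + 1))) ∧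
    {n | g n = a}.Infinite ∧ ∀ t ∈ A, ¬ {n | g n = t}.Infinite

theorem HasRecurrentExecution.of_tPath {S T : Type*} {step : S → T → S → Prop} {a : T}
    {A : Set T} {s s' : S} {σ : List T} (h : TPath step s σ s')
    (h' : HasRecurrentExecution step a A s') : HasRecurrentExecution step a A s := by
  induction h with
  | nil => exact h'
  | @cons s _ _ t _ hs _ ih =>
    obtain ⟨f, g, hf, hstep, ha, hA⟩ := ih h'
    have key : ∀ u, {n : ℕ | (n.casesOn t g : T) = u}.Infinite ↔ {n | g n = u}.Infinite := by
      intro u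
      rw [← Nat.frequently_atTop_iff_infinite, ← Nat.frequently_atTop_iff_infinite]
      conv_lhs => rw [← Filter.map_add_atTop_eq_nat 1, Filter.frequently_map]
    refine ⟨fun n => n.casesOn s f, fun n => n.casesOn t g, rfl, fun n => ?_, (key a).2 ha,
      fun u hu => (key u).not.2 (hA u hu)⟩
    cases n with
    | zero => simpa [hf] using hs
    | succ n => exact hstep n

/-- A cycle whose edges can be relabelled freely yields a recurrent execution. -/
theorem hasRecurrentExecution_of_cycle {S T : Type*} {step : S → T → S → Prop} {a : T}
    {A : Set T} (haA : a ∉ A) {m : ℕ} (hm : 0 < m) {c : ℕ → S} (hc : c m = c 0)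
    (ha : step (c 0) a (c 1))
    (h : ∀ k < m, {t | step (c k) t (c (k + 1))}.Infinite ∨
      ¬ {t | step (c k) t (c (k + 1))} ⊆ A) :
    HasRecurrentExecution step a A (c 0) := by
  have hL : ∀ k, ∃ L : ℕ → T, (k < m → ∀ n, step (c k) (L n) (c (k + 1))) ∧
      ∀ t ∈ A, {n | L n = t}.Finite := by
    intro k
    by_cases hk : k < m
    · obtain ⟨L, hL, hL'⟩ := exists_seq_finite_recurrence (h k hk)
      exact ⟨L, fun _ => hL, hL'⟩
    · refine ⟨fun _ => a, fun hk' => absurd hk' hk, fun t ht => ?_⟩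
      have : {n : ℕ | a = t} = ∅ :=
        Set.eq_empty_of_forall_notMem fun _ hn => haA (hn ▸ ht)
      exact this ▸ Set.finite_empty
  choose L hL hLA using hL
  have hsucc : ∀ n, c ((n + 1) % m) = c (n % m + 1) := by
    intro n
    have hlt := Nat.mod_lt n hm
    rcases Nat.lt_or_ge (n % m + 1) m with h' | h'
    · rw [Nat.add_mod_eq_ite]
      rcases Nat.lt_or_ge 1 m with h1 | h1
      · rw [Nat.mod_eq_of_lt h1, if_neg (by omega)]
      · omega
    · have he : n % m + 1 = m := by omega
      have : (n + 1) % m = 0 := by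
        rw [← Nat.mod_add_mod, he, Nat.mod_self]
      rw [this, he, hc]
  refine ⟨fun n => c (n % m), fun n => if n % m = 0 then a else L (n % m) n, by simp,
    fun n => ?_, ?_, fun t ht => Set.not_infinite.2 ?_⟩
  · dsimp only
    rw [hsucc]
    split_ifs with h0
    · simpa [h0] using ha
    · exact hL _ (Nat.mod_lt n hm) n
  · refine Set.infinite_of_injective_forall_mem (f := fun k => k * m)
      (fun x y hxy => Nat.eq_of_mul_eq_mul_right hm hxy) fun k => ?_
    simp
  · refine ((Set.finite_lt_nat m).biUnion fun k _ => hLA k t ht).subset fun n hn => ?_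
    simp only [Set.mem_ofPred_eq] at hn
    split_ifs at hn with h0
    · exact absurd (hn ▸ ht) haA
    · exact Set.mem_biUnion (show n % m ∈ {i | i < m} from Nat.mod_lt n hm) hn

/-- Finitely many labels occur on those pairs `s → s'` whose labels are finitely many and all in `A`. -/
theorem finite_iUnion_labels {S T : Type*} [Finite S] (step : S → T → S → Prop) (A : Set T) :
    {t | ∃ s s', step s t s' ∧ {u | step s u s'}.Finite ∧ {u | step s u s'} ⊆ A}.Finite := by
  refine (Set.finite_iUnion (f := fun p : S × S =>
    {t | step p.1 t p.2 ∧ {u | step p.1 u p.2}.Finite ∧ {u | step p.1 u p.2} ⊆ A})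
    fun p => ?_).subset ?_
  · by_cases h : {u | step p.1 u p.2}.Finite
    · exact h.subset fun t ht => ht.1
    · exact Set.finite_empty.subset fun t ht => h ht.2.1
  · rintro t ⟨s, s', ht⟩
    exact Set.mem_iUnion.2 ⟨(s, s'), ht⟩

/-- A recurrent execution gives arbitrarily `a`-rich paths to terminal states on which the members
of a finite set `B ⊆ A` occur a bounded number of times. -/
theorem HasRecurrentExecution.exists_rich_tPath {S T : Type*} [Finite S] [DecidableEq T]
    {step : S → T → S → Prop} {a : T} {A : Set T} {s : S}
    (h : HasRecurrentExecution step a A s)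
    (hterm : ∀ s', Reachable step s s' → ∃ s_t, Terminal step s_t ∧ Reachable step s' s_t)
    (p : T → Bool) (hp : {t | p t}.Finite) (hpA : ∀ t, p t → t ∈ A) :
    ∃ K, ∀ N, ∃ σ s_t, Terminal step s_t ∧ TPath step s σ s_t ∧ σ.countP p ≤ K ∧
      N ≤ σ.count a := by
  obtain ⟨f, g, rfl, hstep, ha, hA⟩ := h
  have hτ : ∀ s', ∃ τ : List T, Reachable step (f 0) s' →
      ∃ s_t, Terminal step s_t ∧ TPath step s' τ s_t := by
    intro s'
    by_cases hr : Reachable step (f 0) s'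
    · obtain ⟨s_t, ht, τ, hτ⟩ := hterm s' hr
      exact ⟨τ, fun _ => ⟨s_t, ht, hτ⟩⟩
    · exact ⟨[], fun hr' => absurd hr' hr⟩
  choose τ hτ using hτ
  obtain ⟨M, hM⟩ := (Set.finite_range fun s' => (τ s').length).bddAbove
  have hfin : {n | p (g n)}.Finite := by
    refine (hp.biUnion fun t ht => Set.not_infinite.1 (hA t (hpA t ht))).subset fun n hn => ?_
    exact Set.mem_biUnion (show g n ∈ {t | p t} from hn) rfl
  refine ⟨hfin.toFinset.card + M, fun N => ?_⟩
  have hpath := tPath_map_range hstep (Nat.nth (fun n => g n = a) N)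
  obtain ⟨s_t, ht, hτ'⟩ := hτ _ ⟨_, hpath⟩
  refine ⟨_, s_t, ht, hpath.append hτ', ?_, ?_⟩
  · rw [List.countP_append]
    refine add_le_add ?_ (List.countP_le_length.trans (hM ⟨_, rfl⟩))
    rw [List.countP_map]
    change List.countP (fun n => p (g n)) _ ≤ _
    have hcount : List.countP (fun n => p (g n)) (List.range (Nat.nth (fun n => g n = a) N)) =
        Nat.count (fun n => p (g n) = true) (Nat.nth (fun n => g n = a) N) := by
      simp [Nat.count]
    rw [hcount, Nat.count_eq_card_filter_range]
    refine Finset.card_le_card fun n hn => ?_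
    simpa using (Finset.mem_filter.mp hn).2
  · rw [List.count_append]
    refine le_trans ?_ (Nat.le_add_right _ _)
    rw [List.count, List.countP_map]
    conv_lhs => rw [← Nat.count_nth_of_infinite ha N]
    exact le_of_eq rfl

/-- Theorem 5: on a finite AG EF terminating model, the basic strong stubborn set
method preserves the property "there is an execution where `t_ω` occurs
infinitely many times but no member of `T_*` occurs infinitely many times". -/
theorem stmt13 {S T : Type*} [Finite S] (step : S → T → S → Prop) (𝒯 : S → Set T)
    (sHat : S)
    (hdet : Deterministic step) (h0 : D0 step 𝒯) (h1 : D1 step 𝒯) (h2 : D2 step 𝒯)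
    (hAGEF : ∀ s, Reachable step sHat s →
      ∃ s_t, Terminal step s_t ∧ Reachable step s s_t)
    (t_ω : T) (T_star : Set T) :
    (∃ (f : ℕ → S) (g : ℕ → T), f 0 = sHat ∧ (∀ n, step (f n) (g n) (f (n + 1))) ∧
        {n | g n = t_ω}.Infinite ∧ ∀ t ∈ T_star, ¬ {n | g n = t}.Infinite) ↔
      (∃ (f : ℕ → S) (g : ℕ → T), f 0 = sHat ∧ (∀ n, step (f n) (g n) (f (n + 1))) ∧
        (∀ n, g n ∈ 𝒯 (f n)) ∧
        {n | g n = t_ω}.Infinite ∧ ∀ t ∈ T_star, ¬ {n | g n = t}.Infinite) := by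
  classical
  have := Fintype.ofFinite S
  constructor
  · intro h
    have h : HasRecurrentExecution step t_ω T_star sHat := h
    have hω : t_ω ∉ T_star := by
      obtain ⟨f, g, -, -, hi, hA⟩ := h
      exact fun hmem => hA t_ω hmem hi
    have hB := finite_iUnion_labels (REdge step 𝒯) T_star
    set B := {t | ∃ s s', REdge step 𝒯 s t s' ∧ {u | REdge step 𝒯 s u s'}.Finite ∧
      {u | REdge step 𝒯 s u s'} ⊆ T_star}
    obtain ⟨K, hK⟩ := h.exists_rich_tPath hAGEF (fun t => decide (t ∈ B)) (by simpa using hB)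
      (by
        intro t ht
        obtain ⟨s, s', hs, -, hsub⟩ := of_decide_eq_true ht
        exact hsub hs)
    obtain ⟨σ, s_t, ht, hpath, hcB, hcω⟩ := hK (Fintype.card S * (K + 1) + 1)
    obtain ⟨σ', hperm, hr⟩ := hpath.exists_perm_rEdge h0 h1 h2 ht
    obtain ⟨m, c, l, hm, ⟨τ, hτ⟩, hcm, hl, hc⟩ := hr.exists_cycle t_ω (fun t => decide (t ∈ B)) K
      (by rwa [hperm.countP_eq]) (by rw [hperm.count_eq]; omega)
    have hcyc : HasRecurrentExecution (REdge step 𝒯) t_ω T_star (c 0) := by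
      refine hasRecurrentExecution_of_cycle hω hm hcm (by simpa [hl] using (hc 0 hm).1)
        fun k hk => ?_
      by_contra! hcon
      exact (hc k hk).2 (decide_eq_true
        ⟨_, _, (hc k hk).1, hcon.1, hcon.2⟩)
    obtain ⟨f, g, hf, hstep, hi, hA⟩ := hcyc.of_tPath hτ
    exact ⟨f, g, hf, fun n => (hstep n).1, fun n => (hstep n).2, hi, hA⟩
  · rintro ⟨f, g, hf, hstep, -, hi, hA⟩
    exact ⟨f, g, hf, hstep, hi, hA⟩
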